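/- (Eigenvalue multiplicities of the DFT, case p ≡ 3 mod 4) Write p = 4l + 3. The DFT operator F on ℂ(ZMod p) is diagonalizable with eigenvalues among {1, −1, i, −i}, and the dimensions of its eigenspaces are: dim ker(F − 1) = l + 1, dim ker(F + 1) = l + 1, dim ker(F − i·Id) = l + 1, dim ker(F + i·Id) = l. -/

import Mathlib

open scoped BigOperators

noncomputable section

namespace DFTWeil

open scoped Classical

/-- Multiplication of the Heisenberg group `H = (V × V) × Z`,
`(v,z)·(v',z') = (v+v', z+z'+2⁻¹ ω(v,v'))` with `ω((t,w),(t',w')) = t w' - w t'`. -/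
def hMul {p : ℕ} (a b : (ZMod p × ZMod p) × ZMod p) : (ZMod p × ZMod p) × ZMod p :=
  (a.1 + b.1, a.2 + b.2 + (2 : ZMod p)⁻¹ * (a.1.1 * b.1.2 - a.1.2 * b.1.1))

/-- The additive character `ψ(z) = exp(2πi z/p)`. -/
def psi (p : ℕ) (z : ZMod p) : ℂ :=
  Complex.exp (2 * Real.pi * Complex.I * (z.val : ℂ) / p)

/-- The standard realization of the Heisenberg representation:
`(π((t,w),z) f)(x) = ψ(z + 2⁻¹ t w + w x) f(x+t)`. -/
def heis (p : ℕ) (h : (ZMod p × ZMod p) × ZMod p) :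
    (ZMod p → ℂ) →ₗ[ℂ] (ZMod p → ℂ) where
  toFun f x := psi p (h.2 + (2 : ZMod p)⁻¹ * h.1.1 * h.1.2 + h.1.2 * x) * f (x + h.1.1)
  map_add' f g := by funext x; simp [mul_add]
  map_smul' c f := by funext x; simp [Pi.smul_apply, smul_eq_mul]; ring

/-- The discrete Fourier transform `F[f](y) = p^(-1/2) Σ_x ψ(yx) f(x)`. -/
def dft (p : ℕ) [Fact p.Prime] : Module.End ℂ (ZMod p → ℂ) where
  toFun f y := ((Real.sqrt p : ℂ))⁻¹ * ∑ x : ZMod p, psi p (y * x) * f x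
  map_add' f g := by funext y; simp [mul_add, Finset.sum_add_distrib]
  map_smul' c f := by
    funext y
    simp [Pi.smul_apply, smul_eq_mul, Finset.mul_sum]
    ring_nf
    congr 1
    ext x
    ring

open LinearMap (ker trace IsProj)

section
variable {V : Type*} [AddCommGroup V] [Module ℂ V]

/-- The projection onto the `μ`-eigenspace of an endomorphism with `f ^ 4 = 1`, where `μ ^ 4 = 1`. -/
def eigenProj (f : Module.End ℂ V) (μ : ℂ) : Module.End ℂ V :=
  (1 / 4 : ℂ) • (1 + μ ^ 3 • f + μ ^ 2 • f ^ 2 + μ • f ^ 3)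

lemma isProj_eigenProj {f : Module.End ℂ V} (hf : f ^ 4 = 1) {μ : ℂ} (hμ : μ ^ 4 = 1) :
    IsProj (ker (f - μ • (1 : Module.End ℂ V))) (eigenProj f μ) := by
  constructor
  · intro x
    have h4 : f (f (f (f x))) = x := by
      simpa [pow_succ] using congrArg (fun g : Module.End ℂ V => g x) hf
    simp only [LinearMap.mem_ker, eigenProj, LinearMap.sub_apply, LinearMap.smul_apply,
      LinearMap.add_apply, Module.End.one_apply, pow_succ, pow_zero, one_mul, Module.End.mul_apply,
      map_smul, map_add, h4]
    have hμ' : μ * μ * μ * μ = 1 := by rw [← hμ]; ring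
    match_scalars <;> first | ring1 | linear_combination (-1 / 4 : ℂ) * hμ'
  · intro x hx
    have h1 : f x = μ • x := by simpa [sub_eq_zero] using hx
    simp only [eigenProj, LinearMap.smul_apply, LinearMap.add_apply, Module.End.one_apply,
      pow_succ, pow_zero, one_mul, Module.End.mul_apply, map_smul, h1]
    have hμ' : μ * μ * μ * μ = 1 := by rw [← hμ]; ring
    match_scalars
    linear_combination (3 / 4 : ℂ) * hμ'

lemma pow_four_eq_one_iff {μ : ℂ} :
    μ ^ 4 = 1 ↔ μ = 1 ∨ μ = -1 ∨ μ = Complex.I ∨ μ = -Complex.I := by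
  have h : μ ^ 4 - 1 = (μ - 1) * (μ + 1) * (μ - Complex.I) * (μ + Complex.I) := by
    linear_combination (μ ^ 2 - 1) * Complex.I_sq
  rw [← sub_eq_zero, h]
  simp [sub_eq_zero, add_eq_zero_iff_eq_neg, or_assoc]

lemma sup_ker_eq_top_of_pow_four_eq_one {f : Module.End ℂ V} (hf : f ^ 4 = 1) :
    ker (f - 1) ⊔ ker (f + 1) ⊔ ker (f - Complex.I • (1 : Module.End ℂ V)) ⊔
      ker (f + Complex.I • (1 : Module.End ℂ V)) = ⊤ := by
  rw [eq_top_iff]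
  intro x _
  have hI : Complex.I ^ 4 = 1 := by simp
  have h1 := (isProj_eigenProj hf (μ := 1) (by simp)).map_mem x
  have h2 := (isProj_eigenProj hf (μ := -1) (by norm_num)).map_mem x
  have h3 := (isProj_eigenProj hf hI).map_mem x
  have h4 := (isProj_eigenProj hf (pow_four_eq_one_iff.2 (by simp : -Complex.I = 1 ∨ _))).map_mem x
  rw [one_smul] at h1
  rw [neg_smul, one_smul, sub_neg_eq_add] at h2
  rw [neg_smul, sub_neg_eq_add] at h4
  have hx : eigenProj f 1 x + eigenProj f (-1) x + eigenProj f Complex.I x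
      + eigenProj f (-Complex.I) x = x := by
    simp only [eigenProj, LinearMap.smul_apply, LinearMap.add_apply, Module.End.one_apply]
    match_scalars <;> ring_nf; simp
  rw [← hx]
  exact Submodule.add_mem_sup (Submodule.add_mem_sup (Submodule.add_mem_sup h1 h2) h3) h4

variable [FiniteDimensional ℂ V]

lemma finrank_ker_eq_trace_eigenProj {f : Module.End ℂ V} (hf : f ^ 4 = 1) {μ : ℂ}
    (hμ : μ ^ 4 = 1) :
    (Module.finrank ℂ (ker (f - μ • (1 : Module.End ℂ V))) : ℂ) =
      1 / 4 * (Module.finrank ℂ V + μ ^ 3 * trace ℂ V f + μ ^ 2 * trace ℂ V (f ^ 2)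
        + μ * trace ℂ V (f ^ 3)) := by
  rw [← (isProj_eigenProj hf hμ).trace]
  simp only [eigenProj, map_smul, map_add, LinearMap.trace_one, smul_eq_mul]

lemma finrank_ker_add_eq_trace_eigenProj {f : Module.End ℂ V} (hf : f ^ 4 = 1) {μ : ℂ}
    (hμ : μ ^ 4 = 1) :
    (Module.finrank ℂ (ker (f + μ • (1 : Module.End ℂ V))) : ℂ) =
      1 / 4 * (Module.finrank ℂ V - μ ^ 3 * trace ℂ V f + μ ^ 2 * trace ℂ V (f ^ 2)
        - μ * trace ℂ V (f ^ 3)) := by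
  have h : f - (-μ) • (1 : Module.End ℂ V) = f + μ • 1 := by simp
  rw [← h, finrank_ker_eq_trace_eigenProj hf (by rw [← hμ]; ring)]
  ring

lemma rootMultiplicity_charpoly_eq_finrank_ker {f : Module.End ℂ V} (hf : f ^ 4 = 1) (μ : ℂ) :
    f.charpoly.rootMultiplicity μ =
      Module.finrank ℂ (ker (f - μ • (1 : Module.End ℂ V))) := by
  have hs : f.IsSemisimple := by
    refine Module.End.isSemisimple_of_squarefree_aeval_eq_zero
      (p := (Polynomial.X ^ 4 - 1 : Polynomial ℂ)) ?_ (by simp [hf])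
    exact ((Polynomial.separable_X_pow_sub_C (1 : ℂ) (n := 4) (by norm_num)
      one_ne_zero)).squarefree
  rw [← LinearMap.finrank_maxGenEigenspace_eq, hs.isFinitelySemisimple.maxGenEigenspace_eq_eigenspace,
    Module.End.eigenspace_def]

lemma det_eq_of_pow_four_eq_one {f : Module.End ℂ V} (hf : f ^ 4 = 1) :
    LinearMap.det f = (-1) ^ Module.finrank ℂ (ker (f + 1)) *
      Complex.I ^ Module.finrank ℂ (ker (f - Complex.I • (1 : Module.End ℂ V))) *
      (-Complex.I) ^ Module.finrank ℂ (ker (f + Complex.I • (1 : Module.End ℂ V))) := by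
  have hsub : f.charpoly.roots.toFinset ⊆ {1, -1, Complex.I, -Complex.I} := by
    intro μ hμ
    have hr : f.charpoly.IsRoot μ := Polynomial.isRoot_of_mem_roots (by simpa using hμ)
    rw [← Module.End.hasEigenvalue_iff_isRoot_charpoly] at hr
    obtain ⟨v, hv⟩ := hr.exists_hasEigenvector
    have h4 := hv.pow_apply 4
    rw [hf, Module.End.one_apply] at h4
    have : μ ^ 4 = 1 := by
      have h0 : (μ ^ 4 - 1) • v = 0 := by rw [sub_smul, ← h4, one_smul, sub_self]
      exact sub_eq_zero.1 ((smul_eq_zero.1 h0).resolve_right hv.2)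
    simpa using pow_four_eq_one_iff.1 this
  have e1 : (1 : ℂ) ≠ -1 := by norm_num
  have e2 : (1 : ℂ) ≠ Complex.I := by simp [Complex.ext_iff]
  have e3 : (1 : ℂ) ≠ -Complex.I := by simp [Complex.ext_iff]
  have e4 : (-1 : ℂ) ≠ Complex.I := by simp [Complex.ext_iff]
  have e5 : (-1 : ℂ) ≠ -Complex.I := by simp [Complex.ext_iff]
  have e6 : Complex.I ≠ -Complex.I := by simp [Complex.ext_iff]; norm_num
  rw [Module.End.det_eq_prod_roots_charpoly_of_splits (IsAlgClosed.splits _),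
    Finset.prod_multiset_count_of_subset _ _ hsub]
  simp only [Polynomial.count_roots, rootMultiplicity_charpoly_eq_finrank_ker hf]
  rw [Finset.prod_insert (by simp [e1, e2, e3]), Finset.prod_insert (by simp [e4, e5]),
    Finset.prod_insert (by simp [e6]), Finset.prod_singleton]
  have h1 : f - (-1 : ℂ) • (1 : Module.End ℂ V) = f + 1 := by simp
  have h2 : f - (-Complex.I) • (1 : Module.End ℂ V) = f + Complex.I • 1 := by simp
  rw [h1, h2, one_pow, one_mul, mul_assoc]

end

lemma psi_eq_stdAddChar (p : ℕ) [NeZero p] (z : ZMod p) : psi p z = ZMod.stdAddChar z := by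
  rw [psi, ← Int.cast_natCast, ← ZMod.stdAddChar_coe]
  simp

lemma sum_psi_mul (p : ℕ) [Fact p.Prime] (b : ZMod p) :
    ∑ x : ZMod p, psi p (x * b) = if b = 0 then (p : ℂ) else 0 := by
  simp_rw [psi_eq_stdAddChar]
  rw [AddChar.sum_mulShift b (ZMod.isPrimitive_stdAddChar p)]
  simp [ZMod.card]

lemma psi_add (p : ℕ) [NeZero p] (a b : ZMod p) : psi p (a + b) = psi p a * psi p b := by
  simp_rw [psi_eq_stdAddChar, AddChar.map_add_eq_mul]

lemma conj_psi (p : ℕ) [NeZero p] (a : ZMod p) :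
    (starRingEnd ℂ) (psi p a) = psi p (-a) := by
  simp_rw [psi_eq_stdAddChar, AddChar.map_neg_eq_conj]

lemma inv_sqrt_mul_inv_sqrt (p : ℕ) :
    ((Real.sqrt p : ℂ))⁻¹ * ((Real.sqrt p : ℂ))⁻¹ = (p : ℂ)⁻¹ := by
  rw [← mul_inv, ← Complex.ofReal_mul, Real.mul_self_sqrt (by positivity)]
  simp

lemma dft_sq_apply (p : ℕ) [Fact p.Prime] (g : ZMod p → ℂ) (y : ZMod p) :
    (dft p ^ 2) g y = g (-y) := by
  have hp0 : (p : ℂ) ≠ 0 := Nat.cast_ne_zero.2 (Fact.out : p.Prime).ne_zero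
  rw [pow_two, Module.End.mul_apply]
  simp only [dft, LinearMap.coe_mk, AddHom.coe_mk]
  have : ∀ x : ZMod p, psi p (y * x) * (((Real.sqrt p : ℂ))⁻¹ * ∑ z, psi p (x * z) * g z) =
      ((Real.sqrt p : ℂ))⁻¹ * ∑ z, psi p (x * (y + z)) * g z := by
    intro x
    rw [mul_left_comm, Finset.mul_sum]
    congr 1
    refine Finset.sum_congr rfl fun z _ => ?_
    rw [mul_add, psi_add, mul_comm y x, mul_assoc]
  simp_rw [this]
  rw [← Finset.mul_sum, ← mul_assoc, inv_sqrt_mul_inv_sqrt, Finset.sum_comm]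
  simp_rw [← Finset.sum_mul, sum_psi_mul, add_eq_zero_iff_neg_eq]
  simp [hp0]

lemma dft_pow_four (p : ℕ) [Fact p.Prime] : dft p ^ 4 = 1 := by
  refine LinearMap.ext fun g => funext fun y => ?_
  rw [show 4 = 2 + 2 from rfl, pow_add, Module.End.mul_apply, dft_sq_apply, dft_sq_apply, neg_neg,
    Module.End.one_apply]

/-- The matrix of the discrete Fourier transform in the standard basis. -/
def dftMatrix (p : ℕ) : Matrix (ZMod p) (ZMod p) ℂ :=
  ((Real.sqrt p : ℂ))⁻¹ • Matrix.of fun y x => psi p (y * x)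

lemma toLin'_dftMatrix (p : ℕ) [Fact p.Prime] : Matrix.toLin' (dftMatrix p) = dft p := by
  refine LinearMap.ext fun g => funext fun y => ?_
  simp [dftMatrix, dft, Matrix.mulVec, dotProduct, Finset.mul_sum, mul_assoc]

lemma trace_dft (p : ℕ) [Fact p.Prime] :
    trace ℂ (ZMod p → ℂ) (dft p) = ((Real.sqrt p : ℂ))⁻¹ * ∑ x : ZMod p, psi p (x * x) := by
  rw [← toLin'_dftMatrix, Matrix.trace_toLin'_eq]
  simp [dftMatrix, Matrix.trace, Finset.mul_sum]

lemma two_ne_zero_zmod {p : ℕ} [Fact p.Prime] (hp : p ≠ 2) : (2 : ZMod p) ≠ 0 := by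
  exact Ring.two_ne_zero (by rwa [ZMod.ringChar_zmod_n])

lemma trace_dft_sq {p : ℕ} [Fact p.Prime] (hp : p ≠ 2) :
    trace ℂ (ZMod p → ℂ) (dft p ^ 2) = 1 := by
  rw [← Matrix.toLin'_toMatrix' (dft p ^ 2), Matrix.trace_toLin'_eq]
  have h : ∀ y : ZMod p, -y = y ↔ y = 0 := by
    intro y
    rw [neg_eq_iff_add_eq_zero, ← two_mul, mul_eq_zero_iff_left (two_ne_zero_zmod hp)]
  simp [Matrix.trace, LinearMap.toMatrix'_apply, dft_sq_apply, Pi.single_apply, h]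

lemma normSq_sum_psi_sq {p : ℕ} [Fact p.Prime] (hp : p ≠ 2) :
    (∑ x : ZMod p, psi p (x * x)) * (starRingEnd ℂ) (∑ x : ZMod p, psi p (x * x)) = p := by
  have h2 : (2 : ZMod p) ≠ 0 := two_ne_zero_zmod hp
  rw [map_sum, Finset.sum_mul_sum]
  simp_rw [conj_psi, ← psi_add]
  rw [Finset.sum_comm]
  have : ∀ y : ZMod p, ∑ x : ZMod p, psi p (x * x + -(y * y)) =
      ∑ t : ZMod p, psi p (t * t) * psi p (y * (2 * t)) := by
    intro y
    refine Fintype.sum_equiv (Equiv.subRight y) _ _ fun x => ?_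
    rw [← psi_add, Equiv.subRight_apply]
    congr 1
    ring
  simp_rw [this]
  rw [Finset.sum_comm]
  simp_rw [← Finset.mul_sum, sum_psi_mul]
  simp [h2, psi]

lemma normSq_trace_dft {p : ℕ} [Fact p.Prime] (hp : p ≠ 2) :
    Complex.normSq (trace ℂ (ZMod p → ℂ) (dft p)) = 1 := by
  have hp0 : (p : ℂ) ≠ 0 := Nat.cast_ne_zero.2 (Fact.out : p.Prime).ne_zero
  have h : (Complex.normSq (trace ℂ (ZMod p → ℂ) (dft p)) : ℂ) = 1 := by
    rw [Complex.normSq_eq_conj_mul_self, mul_comm, trace_dft, map_mul, mul_mul_mul_comm,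
      normSq_sum_psi_sq hp, map_inv₀, Complex.conj_ofReal, inv_sqrt_mul_inv_sqrt,
      inv_mul_cancel₀ hp0]
  exact_mod_cast h

lemma two_mul_sum_Ioi_one (n : ℕ) :
    2 * ∑ i : Fin n, ∑ _j ∈ Finset.Ioi i, (1 : ℤ) = n * (n - 1) := by
  induction n with
  | zero => simp
  | succ n ih =>
    rw [Fin.sum_univ_succ, Fin.sum_Ioi_zero]
    simp_rw [Fin.sum_Ioi_succ]
    rw [mul_add, ih]
    simp
    ring

lemma two_mul_sum_Ioi_add (n : ℕ) :
    2 * ∑ i : Fin n, ∑ j ∈ Finset.Ioi i, ((i : ℤ) + (j : ℤ)) = n * (n - 1) ^ 2 := by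
  induction n with
  | zero => simp
  | succ n ih =>
    have h1 := two_mul_sum_Ioi_one n
    have h2 : (∑ j : Fin n, (j : ℤ)) * 2 = n * (n - 1) := by
      rw [Fin.sum_univ_eq_sum_range (fun j => (j : ℤ)) n]
      have := Finset.sum_range_id_mul_two n
      cases n with
      | zero => simp
      | succ m =>
        rw [Nat.add_sub_cancel] at this
        have h := congrArg (Nat.cast : ℕ → ℤ) this
        push_cast at h ⊢
        linear_combination h
    rw [Fin.sum_univ_succ, Fin.sum_Ioi_zero]
    simp_rw [Fin.sum_Ioi_succ]
    have h3 : ∀ i j : Fin n, ((i.succ : Fin (n + 1)) : ℤ) + ((j.succ : Fin (n + 1)) : ℤ)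
        = (i : ℤ) + 1 + ((j : ℤ) + 1) := by
      intro i j; simp
    simp_rw [h3]
    simp only [Finset.sum_add_distrib, Finset.sum_const, Finset.card_univ, Fintype.card_fin,
      nsmul_eq_mul, mul_one, Fin.val_zero, Fin.val_succ, Nat.cast_zero, Nat.cast_add, Nat.cast_one,
      zero_add] at ih h1 ⊢
    linear_combination ih + h2 + 2 * h1

lemma exp_sub_exp (a b : ℝ) :
    Complex.exp (2 * b * Complex.I) - Complex.exp (2 * a * Complex.I) =
      Complex.exp ((a + b) * Complex.I) * Complex.I * ((2 * Real.sin (b - a) : ℝ) : ℂ) := by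
  have h1 : Complex.exp (2 * b * Complex.I) =
      Complex.exp ((a + b) * Complex.I) * Complex.exp ((b - a) * Complex.I) := by
    rw [← Complex.exp_add]; ring_nf
  have h2 : Complex.exp (2 * a * Complex.I) =
      Complex.exp ((a + b) * Complex.I) * Complex.exp (-(b - a) * Complex.I) := by
    rw [← Complex.exp_add]; ring_nf
  rw [h1, h2, Complex.exp_mul_I, Complex.exp_mul_I, Complex.exp_mul_I, Complex.cos_neg, Complex.sin_neg]
  push_cast
  ring

/-- Schur's evaluation of the argument of the determinant of the Fourier matrix. -/
lemma det_vandermonde_rootsOfUnity {l n : ℕ} (hn : n = 2 * l + 1) :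
    ∃ r : ℝ, 0 < r ∧ (Matrix.vandermonde fun i : Fin n =>
      Complex.exp (2 * ((i : ℕ) * Real.pi / n : ℝ) * Complex.I)).det =
        Complex.exp (Real.pi / n * (n * (2 * l ^ 2) : ℕ) * Complex.I) * Complex.I ^ (n * l) * r := by
  refine ⟨∏ i : Fin n, ∏ j ∈ Finset.Ioi i,
    (2 * Real.sin ((j : ℕ) * Real.pi / n - (i : ℕ) * Real.pi / n)), ?_, ?_⟩
  · refine Finset.prod_pos fun i _ => Finset.prod_pos fun j hj => ?_
    have hij : ((i : ℕ) : ℝ) < (j : ℕ) := by exact_mod_cast Finset.mem_Ioi.1 hj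
    have hjn : ((j : ℕ) : ℝ) < n := by exact_mod_cast j.2
    have hi0 : (0 : ℝ) ≤ (i : ℕ) := by positivity
    have hn0 : (0 : ℝ) < n := by linarith
    rw [← sub_div, ← sub_mul]
    refine mul_pos two_pos (Real.sin_pos_of_pos_of_lt_pi ?_ ?_)
    · exact div_pos (mul_pos (sub_pos.2 hij) Real.pi_pos) hn0
    · rw [div_lt_iff₀ hn0, mul_comm Real.pi]
      exact mul_lt_mul_of_pos_right (by linarith) Real.pi_pos
  · rw [Matrix.det_vandermonde]
    simp_rw [Complex.ofReal_prod, exp_sub_exp, Finset.prod_mul_distrib]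
    congr 2
    · simp_rw [← Complex.exp_sum]
      congr 1
      simp_rw [← Finset.sum_mul]
      congr 1
      have h := two_mul_sum_Ioi_add n
      have h' : (2 : ℂ) * ∑ i : Fin n, ∑ j ∈ Finset.Ioi i, (((i : ℕ) : ℂ) + ((j : ℕ) : ℂ))
          = n * (n - 1) ^ 2 := by exact_mod_cast congrArg (Int.cast : ℤ → ℂ) h
      have hl : (n : ℂ) - 1 = 2 * l := by rw [hn]; push_cast; ring
      rw [hl] at h'
      have h'' : ∑ i : Fin n, ∑ j ∈ Finset.Ioi i, (((i : ℕ) : ℂ) + ((j : ℕ) : ℂ))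
          = n * (2 * l ^ 2) := by linear_combination h' / 2
      push_cast
      rw [← h'', Finset.mul_sum]
      refine Finset.sum_congr rfl fun i _ => ?_
      rw [Finset.mul_sum]
      refine Finset.sum_congr rfl fun j _ => ?_
      ring
    · simp_rw [Finset.prod_const]
      rw [Finset.prod_pow_eq_pow_sum]
      congr 1
      have h := two_mul_sum_Ioi_one n
      simp only [Finset.sum_const, nsmul_eq_mul, mul_one] at h
      have hl : (n : ℤ) - 1 = 2 * l := by rw [hn]; push_cast; ring
      rw [hl] at h
      zify
      linarith

lemma bijective_natCast_fin (p : ℕ) [NeZero p] :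
    Function.Bijective fun i : Fin p => ((i : ℕ) : ZMod p) := by
  rw [Fintype.bijective_iff_injective_and_card]
  refine ⟨fun i j h => Fin.ext ?_, by simp [ZMod.card]⟩
  have h' := (ZMod.natCast_eq_natCast_iff' _ _ _).1 h
  rwa [Nat.mod_eq_of_lt i.2, Nat.mod_eq_of_lt j.2] at h'

lemma psi_natCast (p : ℕ) [NeZero p] (k : ℕ) :
    psi p k = Complex.exp (2 * Real.pi * Complex.I * k / p) := by
  rw [psi_eq_stdAddChar, ← Int.cast_natCast, ZMod.stdAddChar_coe, Int.cast_natCast]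

lemma det_dft {p l : ℕ} [Fact p.Prime] (hp : p = 2 * l + 1) :
    ∃ r : ℝ, 0 < r ∧ LinearMap.det (dft p) = Complex.I ^ (p * l) * r := by
  have hp0 : (0 : ℝ) < p := Nat.cast_pos.2 (Fact.out : p.Prime).pos
  have hpc : (p : ℂ) ≠ 0 := Nat.cast_ne_zero.2 (Fact.out : p.Prime).ne_zero
  obtain ⟨r, hr, h⟩ := det_vandermonde_rootsOfUnity hp
  refine ⟨(Real.sqrt p)⁻¹ ^ p * r, by positivity, ?_⟩
  have hexp : Complex.exp (Real.pi / p * (p * (2 * l ^ 2) : ℕ) * Complex.I) = 1 := by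
    rw [Complex.exp_eq_one_iff]
    refine ⟨(l : ℤ) ^ 2, ?_⟩
    push_cast
    field_simp
  have hsub : (Matrix.of fun y x : ZMod p => psi p (y * x)).submatrix
      (Equiv.ofBijective _ (bijective_natCast_fin p)) (Equiv.ofBijective _ (bijective_natCast_fin p))
      = Matrix.vandermonde fun i : Fin p =>
        Complex.exp (2 * ((i : ℕ) * Real.pi / p : ℝ) * Complex.I) := by
    ext i j
    simp only [Matrix.submatrix_apply, Matrix.of_apply, Equiv.ofBijective_apply,
      Matrix.vandermonde_apply]
    rw [← Nat.cast_mul, psi_natCast, ← Complex.exp_nat_mul]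
    congr 1
    push_cast
    ring
  rw [hexp, one_mul, ← hsub, Matrix.det_submatrix_equiv_self] at h
  rw [← toLin'_dftMatrix, LinearMap.det_toLin', dftMatrix, Matrix.det_smul, h, ZMod.card]
  push_cast
  ring

/-- Eigenvalue multiplicities of the DFT for `p = 4l + 3`. -/
theorem stmt17 (p l : ℕ) [Fact p.Prime] (hp : p = 4 * l + 3) :
    (LinearMap.ker (dft p - 1) ⊔ LinearMap.ker (dft p + 1) ⊔
      LinearMap.ker (dft p - Complex.I • 1) ⊔ LinearMap.ker (dft p + Complex.I • 1) = ⊤) ∧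
    Module.finrank ℂ (LinearMap.ker (dft p - 1)) = l + 1 ∧
    Module.finrank ℂ (LinearMap.ker (dft p + 1)) = l + 1 ∧
    Module.finrank ℂ (LinearMap.ker (dft p - Complex.I • 1)) = l + 1 ∧
    Module.finrank ℂ (LinearMap.ker (dft p + Complex.I • 1)) = l := by
  have hp2 : p ≠ 2 := by omega
  have hf := dft_pow_four p
  refine ⟨sup_ker_eq_top_of_pow_four_eq_one hf, ?_⟩
  have hdet := det_eq_of_pow_four_eq_one hf
  obtain ⟨r, hr, hdet'⟩ := det_dft (p := p) (l := 2 * l + 1) (by omega)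
  have ha := finrank_ker_eq_trace_eigenProj hf (μ := 1) (by simp)
  have hb := finrank_ker_add_eq_trace_eigenProj hf (μ := 1) (by simp)
  have hc := finrank_ker_eq_trace_eigenProj hf (μ := Complex.I) (by simp)
  have hd := finrank_ker_add_eq_trace_eigenProj hf (μ := Complex.I) (by simp)
  rw [one_smul] at ha hb
  have hn := normSq_trace_dft hp2
  rw [trace_dft_sq hp2] at ha hb hc hd
  have hfr : (Module.finrank ℂ (ZMod p → ℂ) : ℂ) = 4 * l + 3 := by
    rw [Module.finrank_fintype_fun_eq_card, ZMod.card, hp]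
    push_cast
    ring
  rw [hfr] at ha hb hc hd
  generalize Module.finrank ℂ (LinearMap.ker (dft p - 1)) = a at *
  generalize Module.finrank ℂ (LinearMap.ker (dft p + 1)) = b at *
  generalize Module.finrank ℂ (LinearMap.ker (dft p - Complex.I • 1)) = c at *
  generalize Module.finrank ℂ (LinearMap.ker (dft p + Complex.I • 1)) = d at *
  generalize trace ℂ (ZMod p → ℂ) (dft p) = t at *
  generalize trace ℂ (ZMod p → ℂ) (dft p ^ 3) = s at *
  have hI2 := Complex.I_sq
  have hab : a + b = 2 * l + 2 := by
    have : (a : ℂ) + b = 2 * l + 2 := by rw [ha, hb]; ring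
    exact_mod_cast this
  have hcd : c + d = 2 * l + 1 := by
    have : (c : ℂ) + d = 2 * l + 1 := by
      rw [hc, hd]
      linear_combination (1 / 2 : ℂ) * hI2
    exact_mod_cast this
  have ht : t = ((a : ℝ) - b : ℝ) + ((c : ℝ) - d : ℝ) * Complex.I := by
    push_cast
    rw [ha, hb, hc, hd]
    linear_combination (-1 / 2 * s - 1 / 2 * t * (Complex.I ^ 2 - 1)) * hI2
  rw [ht, Complex.normSq_add_mul_I] at hn
  have hn' : ((a : ℤ) - b) ^ 2 + ((c : ℤ) - d) ^ 2 = 1 := by exact_mod_cast hn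
  have hcd0 : ((c : ℤ) - d) ^ 2 ≥ 1 := by
    have : (c : ℤ) - d ≠ 0 := by omega
    have := sq_pos_of_ne_zero this
    omega
  have hab0 : (a : ℤ) - b = 0 := by
    have h0 := sq_nonneg ((a : ℤ) - b)
    exact pow_eq_zero_iff two_ne_zero |>.1 (by omega)
  have hcd1 : ((c : ℤ) - d) = 1 ∨ (c : ℤ) - d = -1 := by
    refine sq_eq_one_iff.1 ?_
    rw [hab0] at hn'
    linarith
  obtain h | h := hcd1
  · omega
  · exfalso
    obtain rfl : b = l + 1 := by omega
    obtain rfl : c = l := by omega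
    obtain rfl : d = c + 1 := by omega
    have hpow : Complex.I ^ (p * (2 * c + 1)) = (-1) ^ (c + 1) * Complex.I := by
      rw [show p * (2 * c + 1) = 2 * (4 * c ^ 2 + 4 * c + (c + 1)) + 1 by rw [hp]; ring,
        pow_succ, pow_mul, Complex.I_sq, pow_add (-1 : ℂ) (4 * c ^ 2 + 4 * c),
        Even.neg_one_pow (by simp [parity_simps]), one_mul]
    have hII : Complex.I ^ c * (-Complex.I) ^ (c + 1) = -Complex.I := by
      rw [pow_succ, ← mul_assoc, ← mul_pow]
      simp
    rw [hdet', mul_assoc, hII, hpow, mul_assoc] at hdet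
    have h1 := mul_left_cancel₀ (pow_ne_zero _ (by norm_num)) hdet
    have h2 := congrArg Complex.im h1
    simp at h2
    linarith

end DFTWeil
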